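/- Let Ŝ be a soft classifier with a nice accuracy profile for a set of groups 𝒢, and let D̂_{(τ₀,τ₁,R₀,R₁)} be a deferring threshold post-processor satisfying: τ₀(g) = min(Supp(𝒫_g)) and R₀(g) > 0 for all g, and τ₁(g) = max(Supp(𝒫_g)) and R₁(g) > 0 for all g. Then the composed deferring hard classifier Ŷ = D̂_{(τ₀,τ₁,R₀,R₁)}∘Ŝ equalizes both PPV and NPV across all groups in 𝒢: for any g, g' ∈ 𝒢, PPV_{Ŷ,g} = PPV_{Ŷ,g'} and NPV_{Ŷ,g} = NPV_{Ŷ,g'}. -/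

import Mathlib

open Finset
open scoped Classical

namespace GroupFairness

noncomputable section

variable {X 𝒢 Ω : Type*} [Fintype X] [Fintype Ω]

/-- The finset of members of group `g`. -/
def grp (Grp : X → 𝒢) (g : 𝒢) : Finset X :=
  Finset.univ.filter (fun x => Grp x = g)

/-- Expectation of `f x ω` over a uniformly random member `x` of group `g`,
together with internal randomness `ω` distributed according to the weights `w`. -/
def Ex (w : Ω → ℝ) (Grp : X → 𝒢) (g : 𝒢) (f : X → Ω → ℝ) : ℝ :=
  (∑ x ∈ grp Grp g, ∑ ω : Ω, w ω * f x ω) / ((grp Grp g).card : ℝ)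

/-- Probability of the event `E x ω` for a uniformly random member of group `g`. -/
def Pr (w : Ω → ℝ) (Grp : X → 𝒢) (g : 𝒢) (E : X → Ω → Prop) : ℝ :=
  Ex w Grp g (fun x ω => if E x ω then 1 else 0)

/-- Conditional probability of `E` given `F`. -/
def cPr (w : Ω → ℝ) (Grp : X → 𝒢) (g : 𝒢) (E F : X → Ω → Prop) : ℝ :=
  Pr w Grp g (fun x ω => E x ω ∧ F x ω) / Pr w Grp g F

/-- `w` is a probability weighting on the randomness space. -/
def ValidWeights (w : Ω → ℝ) : Prop :=
  (∀ ω, 0 ≤ w ω) ∧ ∑ ω : Ω, w ω = 1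

/-- The base rate of group `g`: the probability that a uniformly random member
of `g` has true type `1`. -/
def BaseRate (w : Ω → ℝ) (Grp : X → 𝒢) (Y : X → Bool) (g : 𝒢) : ℝ :=
  Pr w Grp g (fun x _ => Y x = true)

/-- All scores of the soft classifier lie in `[0,1]`. -/
def IsSoft (S : X → Ω → ℝ) : Prop :=
  ∀ x ω, 0 ≤ S x ω ∧ S x ω ≤ 1

/-- `S` is groupwise calibrated: for every group `g` and score `s` occurring with
positive probability, `Pr[Y = 1 ∣ S = s] = s`. -/
def Calibrated (w : Ω → ℝ) (Grp : X → 𝒢) (Y : X → Bool) (S : X → Ω → ℝ) : Prop :=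
  ∀ (g : 𝒢) (s : ℝ), 0 < Pr w Grp g (fun x ω => S x ω = s) →
    cPr w Grp g (fun x _ => Y x = true) (fun x ω => S x ω = s) = s

/-- The accuracy profile of `S` on group `g`: the pmf of the score `S(X_g)`. -/
def AP (w : Ω → ℝ) (Grp : X → 𝒢) (S : X → Ω → ℝ) (g : 𝒢) (s : ℝ) : ℝ :=
  Pr w Grp g (fun x ω => S x ω = s)

/-- The support of the accuracy profile of `S` on group `g`. -/
def APsupp (w : Ω → ℝ) (Grp : X → 𝒢) (S : X → Ω → ℝ) (g : 𝒢) : Set ℝ :=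
  {s | 0 < AP w Grp S g s}

/-- The accuracy profile is *nice*: all groups have the same support. -/
def NiceAP (w : Ω → ℝ) (Grp : X → 𝒢) (S : X → Ω → ℝ) : Prop :=
  ∀ g g' : 𝒢, APsupp w Grp S g = APsupp w Grp S g'

/-- A (randomized) hard post-processor is described by the probability `q s g` of
outputting `1` on score `s` and group `g`; it is valid if these are probabilities. -/
def ValidPP (q : ℝ → 𝒢 → ℝ) : Prop :=
  ∀ (s : ℝ) (g : 𝒢), 0 ≤ q s g ∧ q s g ≤ 1

/-- Probability that the composed hard classifier `D̂ ∘ Ŝ` outputs `1` on group `g`. -/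
def prPos (w : Ω → ℝ) (Grp : X → 𝒢) (S : X → Ω → ℝ) (q : ℝ → 𝒢 → ℝ) (g : 𝒢) : ℝ :=
  Ex w Grp g (fun x ω => q (S x ω) (Grp x))

/-- Probability that the composed hard classifier `D̂ ∘ Ŝ` outputs `0` on group `g`. -/
def prNeg (w : Ω → ℝ) (Grp : X → 𝒢) (S : X → Ω → ℝ) (q : ℝ → 𝒢 → ℝ) (g : 𝒢) : ℝ :=
  Ex w Grp g (fun x ω => 1 - q (S x ω) (Grp x))

/-- The composed hard classifier is non-trivial on `g`. -/
def NonTrivial (w : Ω → ℝ) (Grp : X → 𝒢) (S : X → Ω → ℝ) (q : ℝ → 𝒢 → ℝ) (g : 𝒢) : Prop :=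
  0 < prPos w Grp S q g ∧ 0 < prNeg w Grp S q g

/-- Positive predictive value `Pr[Y = 1 ∣ Ŷ = 1]` of the composed classifier on `g`. -/
def PPV (w : Ω → ℝ) (Grp : X → 𝒢) (Y : X → Bool) (S : X → Ω → ℝ)
    (q : ℝ → 𝒢 → ℝ) (g : 𝒢) : ℝ :=
  Ex w Grp g (fun x ω => (if Y x then 1 else 0) * q (S x ω) (Grp x)) / prPos w Grp S q g

/-- Negative predictive value `Pr[Y = 0 ∣ Ŷ = 0]` of the composed classifier on `g`. -/
def NPV (w : Ω → ℝ) (Grp : X → 𝒢) (Y : X → Bool) (S : X → Ω → ℝ)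
    (q : ℝ → 𝒢 → ℝ) (g : 𝒢) : ℝ :=
  Ex w Grp g (fun x ω => (if Y x then 0 else 1) * (1 - q (S x ω) (Grp x))) / prNeg w Grp S q g

/-- False positive rate `Pr[Ŷ = 1 ∣ Y = 0]` of the composed classifier on `g`. -/
def FPR (w : Ω → ℝ) (Grp : X → 𝒢) (Y : X → Bool) (S : X → Ω → ℝ)
    (q : ℝ → 𝒢 → ℝ) (g : 𝒢) : ℝ :=
  Ex w Grp g (fun x ω => (if Y x then 0 else 1) * q (S x ω) (Grp x)) /
    Pr w Grp g (fun x _ => Y x = false)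

/-- False negative rate `Pr[Ŷ = 0 ∣ Y = 1]` of the composed classifier on `g`. -/
def FNR (w : Ω → ℝ) (Grp : X → 𝒢) (Y : X → Bool) (S : X → Ω → ℝ)
    (q : ℝ → 𝒢 → ℝ) (g : 𝒢) : ℝ :=
  Ex w Grp g (fun x ω => (if Y x then 1 else 0) * (1 - q (S x ω) (Grp x))) /
    Pr w Grp g (fun x _ => Y x = true)

/-- The threshold post-processor with threshold `τ g` and on-threshold probability
`R g` for group `g`: it outputs `1` with probability `1` above the threshold, `0`
below it, and `1` with probability `R g` at the threshold. -/
def thresholdPP (τ R : 𝒢 → ℝ) : ℝ → 𝒢 → ℝ := fun s g =>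
  if τ g < s then 1 else if s = τ g then R g else 0

/-- Probability that the deferring threshold post-processor with upper threshold `τ₁ g`
and on-threshold probability `R₁ g` outputs `1` on score `s` and group `g`. -/
def defPos (τ₁ R₁ : 𝒢 → ℝ) : ℝ → 𝒢 → ℝ := fun s g =>
  if τ₁ g < s then 1 else if s = τ₁ g then R₁ g else 0

/-- Probability that the deferring threshold post-processor with lower threshold `τ₀ g`
and on-threshold probability `R₀ g` outputs `0` on score `s` and group `g`
(otherwise, between the thresholds, it defers). -/
def defNeg (τ₀ R₀ : 𝒢 → ℝ) : ℝ → 𝒢 → ℝ := fun s g =>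
  if s < τ₀ g then 1 else if s = τ₀ g then R₀ g else 0

/-- PPV `Pr[Y = 1 ∣ Ŷ = 1]` of a deferring classifier, where `qpos s g` is the
probability of predicting `1` on score `s` and group `g`. -/
def dPPV (w : Ω → ℝ) (Grp : X → 𝒢) (Y : X → Bool) (S : X → Ω → ℝ)
    (qpos : ℝ → 𝒢 → ℝ) (g : 𝒢) : ℝ :=
  Ex w Grp g (fun x ω => (if Y x then 1 else 0) * qpos (S x ω) (Grp x)) /
    Ex w Grp g (fun x ω => qpos (S x ω) (Grp x))

/-- NPV `Pr[Y = 0 ∣ Ŷ = 0]` of a deferring classifier, where `qneg s g` is the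
probability of predicting `0` on score `s` and group `g`. -/
def dNPV (w : Ω → ℝ) (Grp : X → 𝒢) (Y : X → Bool) (S : X → Ω → ℝ)
    (qneg : ℝ → 𝒢 → ℝ) (g : 𝒢) : ℝ :=
  Ex w Grp g (fun x ω => (if Y x then 0 else 1) * qneg (S x ω) (Grp x)) /
    Ex w Grp g (fun x ω => qneg (S x ω) (Grp x))

theorem Ex_congr {w : Ω → ℝ} {Grp : X → 𝒢} {g : 𝒢} {f h : X → Ω → ℝ}
    (H : ∀ x, Grp x = g → ∀ ω, w ω ≠ 0 → f x ω = h x ω) :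
    Ex w Grp g f = Ex w Grp g h := by
  unfold Ex
  congr 1
  refine Finset.sum_congr rfl fun x hx => Finset.sum_congr rfl fun ω _ => ?_
  by_cases hω : w ω = 0
  · simp [hω]
  · rw [H x (by simpa [grp] using hx) ω hω]

theorem Ex_const_mul (w : Ω → ℝ) (Grp : X → 𝒢) (g : 𝒢) (c : ℝ) (f : X → Ω → ℝ) :
    Ex w Grp g (fun x ω => c * f x ω) = c * Ex w Grp g f := by
  unfold Ex
  rw [← mul_div_assoc]
  simp only [Finset.mul_sum, mul_left_comm]

theorem Ex_sub (w : Ω → ℝ) (Grp : X → 𝒢) (g : 𝒢) (f h : X → Ω → ℝ) :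
    Ex w Grp g (fun x ω => f x ω - h x ω) = Ex w Grp g f - Ex w Grp g h := by
  unfold Ex
  rw [← sub_div]
  simp only [mul_sub, Finset.sum_sub_distrib]

/-- A score attained on a member of `g` with positive weight lies in the support of the
accuracy profile. -/
theorem score_mem_APsupp {w : Ω → ℝ} (hw : ∀ ω, 0 ≤ w ω) (Grp : X → 𝒢) (S : X → Ω → ℝ)
    (x : X) {ω : Ω} (hω : w ω ≠ 0) : S x ω ∈ APsupp w Grp S (Grp x) := by
  have hx : x ∈ grp Grp (Grp x) := by simp [grp]
  have hnn : ∀ y ω', 0 ≤ w ω' * (if S y ω' = S x ω then (1 : ℝ) else 0) := fun y ω' =>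
    mul_nonneg (hw ω') (by split_ifs <;> norm_num)
  simp only [APsupp, AP, Pr, Ex, Set.mem_ofPred_eq]
  refine div_pos ?_ (Nat.cast_pos.mpr (Finset.card_pos.mpr ⟨x, hx⟩))
  refine Finset.sum_pos' (fun y _ => Finset.sum_nonneg fun ω' _ => hnn y ω') ⟨x, hx, ?_⟩
  refine Finset.sum_pos' (fun ω' _ => hnn x ω') ⟨ω, Finset.mem_univ ω, ?_⟩
  simpa using lt_of_le_of_ne (hw ω) hω.symm

/-- If a calibrated classifier is post-processed so that a prediction is made only on the
score `t`, with probability `r > 0`, then its PPV is `t` and its NPV is `1 - t`. -/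
theorem dPPV_dNPV_of_single_score {w : Ω → ℝ} (hw : ∀ ω, 0 ≤ w ω) {Grp : X → 𝒢}
    {Y : X → Bool} {S : X → Ω → ℝ} (hcal : Calibrated w Grp Y S) {q : ℝ → 𝒢 → ℝ} {g : 𝒢}
    {t r : ℝ} (ht : t ∈ APsupp w Grp S g) (hr : 0 < r)
    (hq : ∀ s ∈ APsupp w Grp S g, q s g = r * (if s = t then 1 else 0)) :
    dPPV w Grp Y S q g = t ∧ dNPV w Grp Y S q g = 1 - t := by
  set p := Pr w Grp g (fun x ω => S x ω = t) with hp
  have hp0 : 0 < p := ht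
  have hq' : ∀ x, Grp x = g → ∀ ω, w ω ≠ 0 →
      q (S x ω) (Grp x) = r * (if S x ω = t then 1 else 0) := by
    rintro x rfl ω hω
    exact hq _ (score_mem_APsupp hw Grp S x hω)
  have hpt : Pr w Grp g (fun x ω => Y x = true ∧ S x ω = t) = t * p :=
    (div_eq_iff hp0.ne').mp (hcal g t hp0)
  have hden : Ex w Grp g (fun x ω => q (S x ω) (Grp x)) = r * p := by
    rw [Ex_congr hq', Ex_const_mul]
    rfl
  have hpos : Ex w Grp g (fun x ω => (if Y x then 1 else 0) * q (S x ω) (Grp x)) =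
      r * (t * p) := by
    rw [← hpt, Pr, ← Ex_const_mul]
    refine Ex_congr fun x hx ω hω => ?_
    rw [hq' x hx ω hω]
    by_cases hY : Y x = true <;> by_cases hs : S x ω = t <;> simp [hY, hs]
  have hneg : Ex w Grp g (fun x ω => (if Y x then 0 else 1) * q (S x ω) (Grp x)) =
      r * p - r * (t * p) := by
    rw [← hden, ← hpos, ← Ex_sub]
    refine Ex_congr fun x _ ω _ => ?_
    by_cases hY : Y x = true <;> simp [hY]
  unfold dPPV dNPV
  rw [hden, hpos, hneg]
  constructor <;> field_simp

/-- For a (groupwise calibrated) soft classifier with a nice accuracy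
profile, every deferring threshold post-processor whose lower threshold is the minimum
and whose upper threshold is the maximum of the (common) support, with positive
on-threshold probabilities, equalizes both PPV and NPV across all groups. -/
theorem extreme_deferring_thresholds_equalize_PPV_NPV
    (w : Ω → ℝ) (Grp : X → 𝒢) (Y : X → Bool) (S : X → Ω → ℝ)
    (τ₀ τ₁ R₀ R₁ : 𝒢 → ℝ)
    (hw : ValidWeights w) (hne : ∀ g : 𝒢, (grp Grp g).Nonempty)
    (hS : IsSoft S) (hcal : Calibrated w Grp Y S) (hnice : NiceAP w Grp S)
    (hτ₀ : ∀ g : 𝒢, τ₀ g ∈ APsupp w Grp S g ∧ ∀ s ∈ APsupp w Grp S g, τ₀ g ≤ s)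
    (hτ₁ : ∀ g : 𝒢, τ₁ g ∈ APsupp w Grp S g ∧ ∀ s ∈ APsupp w Grp S g, s ≤ τ₁ g)
    (hR₀ : ∀ g : 𝒢, 0 < R₀ g ∧ R₀ g ≤ 1)
    (hR₁ : ∀ g : 𝒢, 0 < R₁ g ∧ R₁ g ≤ 1)
    (hsum : ∀ g : 𝒢, τ₀ g = τ₁ g → R₀ g + R₁ g ≤ 1)
    (g g' : 𝒢) :
    dPPV w Grp Y S (defPos τ₁ R₁) g = dPPV w Grp Y S (defPos τ₁ R₁) g' ∧
      dNPV w Grp Y S (defNeg τ₀ R₀) g = dNPV w Grp Y S (defNeg τ₀ R₀) g' := by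
  have hτ₁_eq : τ₁ g = τ₁ g' :=
    le_antisymm ((hτ₁ g').2 _ (hnice g g' ▸ (hτ₁ g).1)) ((hτ₁ g).2 _ (hnice g' g ▸ (hτ₁ g').1))
  have hτ₀_eq : τ₀ g = τ₀ g' :=
    le_antisymm ((hτ₀ g).2 _ (hnice g' g ▸ (hτ₀ g').1)) ((hτ₀ g').2 _ (hnice g g' ▸ (hτ₀ g).1))
  have hPPV : ∀ k, dPPV w Grp Y S (defPos τ₁ R₁) k = τ₁ k := fun k =>
    (dPPV_dNPV_of_single_score hw.1 hcal (hτ₁ k).1 (hR₁ k).1 fun s hs => by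
      simp [defPos, ((hτ₁ k).2 s hs).not_gt]).1
  have hNPV : ∀ k, dNPV w Grp Y S (defNeg τ₀ R₀) k = 1 - τ₀ k := fun k =>
    (dPPV_dNPV_of_single_score hw.1 hcal (hτ₀ k).1 (hR₀ k).1 fun s hs => by
      simp [defNeg, ((hτ₀ k).2 s hs).not_gt]).2
  rw [hPPV, hPPV, hNPV, hNPV, hτ₁_eq, hτ₀_eq]
  exact ⟨rfl, rfl⟩

end

end GroupFairness
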